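/- arXiv:1604.05392 — 2 statements merged into one kernel-verified Lean document; each statement's English description precedes it below -/
import Mathlib

section
/- Let M be a 3-dimensional pseudo-Hermitian manifold with local coframe θ, e₁, e₂, with dθ = e₁∧e₂ and Je₂ = e₁, and ω determined by the structure equations. The canonical partial connection on Λ¹ (given by ∇_Hθ = e₁⊗e₂ − e₂⊗e₁, ∇_He₁ = ω_H⊗e₂, ∇_He₂ = −ω_H⊗e₁, where ω_H is the image of ω in Λ¹_H) has a unique promotion to a full connection ∇ on Λ¹ satisfying the conditions of the promotion proposition, and it is given by ∇θ = e₁⊗e₂ − e₂⊗e₁, ∇e₁ = (ω − Rθ)⊗e₂, ∇e₂ = (Rθ − ω)⊗e₁, where R is the Tanaka–Webster curvature function determined by dω∧θ = R θ∧e₁∧e₂. -/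
set_option maxSynthPendingDepth 5

noncomputable section

/-- The model space `ℝ³` (the 3-manifold `M` is an open subset `U ⊆ E3`). -/
abbrev E3 : Type := EuclideanSpace ℝ (Fin 3)

/-- Covectors: the fibre of the cotangent bundle `Λ¹`. A 1-form is a map `E3 → Cov3`. -/
abbrev Cov3 : Type := E3 →L[ℝ] ℝ

/-- Smooth functions on `U` (with values in a normed space). -/
abbrev SmoothOnD {F : Type*} [NormedAddCommGroup F] [NormedSpace ℝ F]
    (f : E3 → F) (U : Set E3) : Prop :=
  ContDiffOn ℝ (⊤ : ℕ∞) f U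

/-- The exterior derivative of a 1-form, via the Fréchet derivative. -/
def extDer (α : E3 → Cov3) (x u v : E3) : ℝ :=
  fderiv ℝ α x u v - fderiv ℝ α x v u

/-- The wedge product of two 1-forms, evaluated at `(u, v)`. -/
def w2 (α β : E3 → Cov3) (x u v : E3) : ℝ :=
  α x u * β x v - α x v * β x u

/-- `θ` is a contact form on `U`. -/
def IsContactForm (U : Set E3) (θ : E3 → Cov3) : Prop :=
  SmoothOnD θ U ∧ ∀ x ∈ U, θ x ≠ 0 ∧
    ∀ v, θ x v = 0 → (∀ w, θ x w = 0 → extDer θ x v w = 0) → v = 0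

/-- `(θ, e₁, e₂)` is a smooth local coframe on `U` with `dθ = e₁ ∧ e₂`. -/
def IsAdaptedCoframe (U : Set E3) (θ e₁ e₂ : E3 → Cov3) : Prop :=
  SmoothOnD θ U ∧ SmoothOnD e₁ U ∧ SmoothOnD e₂ U ∧
  (∀ x ∈ U, LinearIndependent ℝ ![θ x, e₁ x, e₂ x]) ∧
  (∀ x ∈ U, ∀ u v : E3, extDer θ x u v = w2 e₁ e₂ x u v)

/-- The CR structure `J` on `H = ker θ` satisfies `J² = -Id` and `J e₂ = e₁`
(the endomorphism `J` acting on `Λ¹_H` by duality). -/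
def JCompat (U : Set E3) (θ e₁ e₂ : E3 → Cov3) (J : E3 → (E3 →L[ℝ] E3)) : Prop :=
  (∀ x ∈ U, ∀ v : E3, θ x v = 0 → θ x (J x v) = 0) ∧
  (∀ x ∈ U, ∀ v : E3, θ x v = 0 → J x (J x v) = -v) ∧
  (∀ x ∈ U, ∀ v : E3, θ x v = 0 → e₁ x v = e₂ x (J x v))

/-- The structure equations `de₁ = ω∧e₂ + Aθ∧e₁ + Bθ∧e₂` and
`de₂ = -ω∧e₁ + Bθ∧e₁ - Aθ∧e₂` on `U`. -/
def StructureEquations (U : Set E3) (θ e₁ e₂ ω : E3 → Cov3) (A B : E3 → ℝ) : Prop :=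
  ∀ x ∈ U, ∀ u v : E3,
    extDer e₁ x u v
      = w2 ω e₂ x u v + A x * w2 θ e₁ x u v + B x * w2 θ e₂ x u v ∧
    extDer e₂ x u v
      = - w2 ω e₁ x u v + B x * w2 θ e₁ x u v - A x * w2 θ e₂ x u v



/-- `(T, X₁, X₂)` is the frame of vector fields dual to the coframe `(θ, e₁, e₂)`. -/
def IsDualFrame (U : Set E3) (θ e₁ e₂ : E3 → Cov3) (T X₁ X₂ : E3 → E3) : Prop :=
  ∀ x ∈ U, θ x (T x) = 1 ∧ e₁ x (T x) = 0 ∧ e₂ x (T x) = 0 ∧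
    θ x (X₁ x) = 0 ∧ e₁ x (X₁ x) = 1 ∧ e₂ x (X₁ x) = 0 ∧
    θ x (X₂ x) = 0 ∧ e₁ x (X₂ x) = 0 ∧ e₂ x (X₂ x) = 1

/-- Christoffel term of the canonical partial connection `∇_H θ = e₁⊗e₂ - e₂⊗e₁`,
`∇_H e₁ = ω_H ⊗ e₂`, `∇_H e₂ = -ω_H ⊗ e₁` on `Λ¹`, obtained by expanding
`σ = σ(T)θ + σ(X₁)e₁ + σ(X₂)e₂` and using the Leibniz rule (only the values with
`u ∈ H x` are relevant). -/
def christPC (θ e₁ e₂ : E3 → Cov3) (T X₁ X₂ : E3 → E3) (ω : E3 → Cov3)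
    (x u : E3) (α : Cov3) : Cov3 :=
  α (fderiv ℝ T x u) • θ x + α (fderiv ℝ X₁ x u) • e₁ x + α (fderiv ℝ X₂ x u) • e₂ x
    + α (T x) • (e₁ x u • e₂ x - e₂ x u • e₁ x)
    + (α (X₁ x) * ω x u) • e₂ x - (α (X₂ x) * ω x u) • e₁ x

/-- Christoffel term of the claimed promoted connection `∇θ = e₁⊗e₂ - e₂⊗e₁`,
`∇e₁ = (ω - Rθ) ⊗ e₂`, `∇e₂ = (Rθ - ω) ⊗ e₁` on `Λ¹`. -/
def christProm (θ e₁ e₂ : E3 → Cov3) (T X₁ X₂ : E3 → E3) (ω : E3 → Cov3) (R : E3 → ℝ)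
    (x u : E3) (α : Cov3) : Cov3 :=
  α (fderiv ℝ T x u) • θ x + α (fderiv ℝ X₁ x u) • e₁ x + α (fderiv ℝ X₂ x u) • e₂ x
    + α (T x) • (e₁ x u • e₂ x - e₂ x u • e₁ x)
    + (α (X₁ x) * (ω x u - R x * θ x u)) • e₂ x
    - (α (X₂ x) * (ω x u - R x * θ x u)) • e₁ x

/-- Covariant derivative on `Λ¹` for a connection given by a Christoffel term. -/
def covD1 (Γ : E3 → E3 → Cov3 → Cov3) (σ : E3 → Cov3) (x u : E3) : Cov3 :=
  fderiv ℝ σ x u + Γ x u (σ x)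

/-- The composition `Λ¹ →(∇) Λ¹⊗Λ¹ →(∇_H) Λ²_H⊗Λ¹` of a full connection `Γ` on `Λ¹`
with the operator `∇_H : Λ¹⊗Λ¹ → Λ²_H⊗Λ¹` induced by the canonical partial connection,
characterised by `∇_H(ω⊗σ) = d_Hω⊗σ - ω_H∧∇_Hσ`; evaluated at `((u,v), w)` with only
`u, v ∈ H x` relevant. -/
def secondOp1 (θ e₁ e₂ : E3 → Cov3) (T X₁ X₂ : E3 → E3) (ω : E3 → Cov3)
    (Γ : E3 → E3 → Cov3 → Cov3) (σ : E3 → Cov3) (x u v w : E3) : ℝ :=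
  fderiv ℝ (fun y => covD1 Γ σ y v w) x u - fderiv ℝ (fun y => covD1 Γ σ y u w) x v
    + christPC θ e₁ e₂ T X₁ X₂ ω x u (covD1 Γ σ x v) w
    - christPC θ e₁ e₂ T X₁ X₂ ω x v (covD1 Γ σ x u) w

/-- The 3-form `dω ∧ θ` evaluated at `(u, v, w)`. -/
def dωθ (ω θ : E3 → Cov3) (x u v w : E3) : ℝ :=
  extDer ω x u v * θ x w + extDer ω x v w * θ x u + extDer ω x w u * θ x v

/-- The 3-form `θ ∧ e₁ ∧ e₂` evaluated at `(u, v, w)`. -/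
def w111 (θ e₁ e₂ : E3 → Cov3) (x u v w : E3) : ℝ :=
  θ x u * w2 e₁ e₂ x v w - θ x v * w2 e₁ e₂ x u w + θ x w * w2 e₁ e₂ x u v

theorem SmoothOnD.contDiffAt' {F : Type*} [NormedAddCommGroup F] [NormedSpace ℝ F]
    {f : E3 → F} {U : Set E3} (hf : SmoothOnD f U) (hU : IsOpen U) {x : E3} (hx : x ∈ U) :
    ContDiffAt ℝ (⊤ : ℕ∞) f x :=
  hf.contDiffAt (hU.mem_nhds hx)

theorem SmoothOnD.differentiableAt' {F : Type*} [NormedAddCommGroup F] [NormedSpace ℝ F]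
    {f : E3 → F} {U : Set E3} (hf : SmoothOnD f U) (hU : IsOpen U) {x : E3} (hx : x ∈ U) :
    DifferentiableAt ℝ f x :=
  (hf.contDiffAt' hU hx).differentiableAt (by simp)

theorem SmoothOnD.fderiv' {F : Type*} [NormedAddCommGroup F] [NormedSpace ℝ F]
    {f : E3 → F} {U : Set E3} (hf : SmoothOnD f U) (hU : IsOpen U) :
    SmoothOnD (fderiv ℝ f) U :=
  hf.fderiv_of_isOpen hU (by simp)

theorem SmoothOnD.fderiv_symm {f : E3 → ℝ} {U : Set E3} (hf : SmoothOnD f U) (hU : IsOpen U)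
    {x : E3} (hx : x ∈ U) (u v : E3) :
    fderiv ℝ (fderiv ℝ f) x u v = fderiv ℝ (fderiv ℝ f) x v u :=
  ((hf.contDiffAt' hU hx).isSymmSndFDerivAt (by
    rw [minSmoothness_of_isRCLikeNormedField]
    exact WithTop.coe_le_coe.2 (le_top : (2 : ℕ∞) ≤ ⊤))).eq u v

/-- Expansion of a vector in the frame dual to a coframe. -/
theorem IsDualFrame.vec_eq {U : Set E3} {θ e₁ e₂ : E3 → Cov3} {T X₁ X₂ : E3 → E3}
    (h : IsDualFrame U θ e₁ e₂ T X₁ X₂) {x : E3} (hx : x ∈ U) (v : E3) :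
    v = θ x v • T x + e₁ x v • X₁ x + e₂ x v • X₂ x := by
  obtain ⟨h1, h2, h3, h4, h5, h6, h7, h8, h9⟩ := h x hx
  have hli : LinearIndependent ℝ ![T x, X₁ x, X₂ x] := by
    rw [Fintype.linearIndependent_iff]
    intro g hg
    simp only [Fin.sum_univ_three, Matrix.cons_val_zero, Matrix.cons_val_one,
      Matrix.cons_val] at hg
    have a0 := congrArg (θ x) hg
    have a1 := congrArg (e₁ x) hg
    have a2 := congrArg (e₂ x) hg
    simp [h1, h2, h3, h4, h5, h6, h7, h8, h9] at a0 a1 a2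
    intro i
    fin_cases i <;> simp [a0, a1, a2]
  have hspan := hli.span_eq_top_of_card_eq_finrank (by simp)
  have hv : v ∈ Submodule.span ℝ (Set.range ![T x, X₁ x, X₂ x]) := by rw [hspan]; trivial
  obtain ⟨c, rfl⟩ := (Submodule.mem_span_range_iff_exists_fun ℝ).1 hv
  simp [Fin.sum_univ_three, h1, h2, h3, h4, h5, h6, h7, h8, h9]

/-- Expansion of a covector in a coframe. -/
theorem IsDualFrame.cov_apply {U : Set E3} {θ e₁ e₂ : E3 → Cov3} {T X₁ X₂ : E3 → E3}
    (h : IsDualFrame U θ e₁ e₂ T X₁ X₂) {x : E3} (hx : x ∈ U) (α : Cov3) (w : E3) :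
    α w = α (T x) * θ x w + α (X₁ x) * e₁ x w + α (X₂ x) * e₂ x w := by
  conv_lhs => rw [h.vec_eq hx w]
  simp only [map_add, map_smul, smul_eq_mul]
  ring

theorem christProm_eq_christPC (θ e₁ e₂ : E3 → Cov3) (T X₁ X₂ : E3 → E3) (ω : E3 → Cov3)
    (R : E3 → ℝ) :
    christProm θ e₁ e₂ T X₁ X₂ ω R
      = christPC θ e₁ e₂ T X₁ X₂ (fun y => ω y - R y • θ y) := by
  funext x u α
  simp [christProm, christPC]

theorem christPC_add_smul (θ e₁ e₂ : E3 → Cov3) (T X₁ X₂ : E3 → E3) (ψ : E3 → Cov3)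
    (x u v : E3) (c : ℝ) (α : Cov3) :
    christPC θ e₁ e₂ T X₁ X₂ ψ x (u + c • v) α
      = christPC θ e₁ e₂ T X₁ X₂ ψ x u α + c • christPC θ e₁ e₂ T X₁ X₂ ψ x v α := by
  ext w
  simp [christPC]
  ring

/-- The covariant derivative in terms of the components of a 1-form in the coframe. -/
theorem covD1_christPC_apply {U : Set E3} {θ e₁ e₂ : E3 → Cov3} {T X₁ X₂ : E3 → E3}
    (h : IsDualFrame U θ e₁ e₂ T X₁ X₂) (ψ : E3 → Cov3) {x : E3} (hx : x ∈ U)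
    {σ : E3 → Cov3} (hσ : DifferentiableAt ℝ σ x) (hT : DifferentiableAt ℝ T x)
    (hX₁ : DifferentiableAt ℝ X₁ x) (hX₂ : DifferentiableAt ℝ X₂ x) (u w : E3) :
    covD1 (christPC θ e₁ e₂ T X₁ X₂ ψ) σ x u w
      = fderiv ℝ (fun y => σ y (T y)) x u * θ x w
        + (fderiv ℝ (fun y => σ y (X₁ y)) x u - σ x (T x) * e₂ x u - σ x (X₂ x) * ψ x u) * e₁ x w
        + (fderiv ℝ (fun y => σ y (X₂ y)) x u + σ x (T x) * e₁ x u + σ x (X₁ x) * ψ x u)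
          * e₂ x w := by
  rw [fderiv_clm_apply hσ hT, fderiv_clm_apply hσ hX₁, fderiv_clm_apply hσ hX₂]
  have := h.cov_apply hx (fderiv ℝ σ x u) w
  simp [covD1, christPC]
  rw [this]
  ring

theorem differentiableAt_covD1_christPC {U : Set E3} (hU : IsOpen U)
    {θ e₁ e₂ ψ σ : E3 → Cov3} {T X₁ X₂ : E3 → E3}
    (hθ : SmoothOnD θ U) (he₁ : SmoothOnD e₁ U) (he₂ : SmoothOnD e₂ U)
    (hT : SmoothOnD T U) (hX₁ : SmoothOnD X₁ U) (hX₂ : SmoothOnD X₂ U)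
    (hψ : SmoothOnD ψ U) (hσ : SmoothOnD σ U) {x : E3} (hx : x ∈ U) (v : E3) :
    DifferentiableAt ℝ (fun y => covD1 (christPC θ e₁ e₂ T X₁ X₂ ψ) σ y v) x := by
  have d1 := hθ.differentiableAt' hU hx
  have d2 := he₁.differentiableAt' hU hx
  have d3 := he₂.differentiableAt' hU hx
  have d4 := hT.differentiableAt' hU hx
  have d5 := hX₁.differentiableAt' hU hx
  have d6 := hX₂.differentiableAt' hU hx
  have d7 := hψ.differentiableAt' hU hx
  have d8 := hσ.differentiableAt' hU hx
  have d9 := (hσ.fderiv' hU).differentiableAt' hU hx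
  have d10 := (hT.fderiv' hU).differentiableAt' hU hx
  have d11 := (hX₁.fderiv' hU).differentiableAt' hU hx
  have d12 := (hX₂.fderiv' hU).differentiableAt' hU hx
  unfold covD1 christPC
  fun_prop

theorem fderiv_clm_apply_const {τ : E3 → Cov3} {x : E3} (hτ : DifferentiableAt ℝ τ x) (u w : E3) :
    fderiv ℝ (fun y => τ y w) x u = fderiv ℝ τ x u w := by
  rw [fderiv_clm_apply hτ (differentiableAt_const w)]
  simp

/-- The second operator as an antisymmetrised iterated covariant derivative. -/
theorem secondOp1_eq {θ e₁ e₂ ω σ : E3 → Cov3} {T X₁ X₂ : E3 → E3}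
    {Γ : E3 → E3 → Cov3 → Cov3} {x : E3}
    (hd : ∀ v, DifferentiableAt ℝ (fun y => covD1 Γ σ y v) x) (u v w : E3) :
    secondOp1 θ e₁ e₂ T X₁ X₂ ω Γ σ x u v w
      = covD1 (christPC θ e₁ e₂ T X₁ X₂ ω) (fun y => covD1 Γ σ y v) x u w
        - covD1 (christPC θ e₁ e₂ T X₁ X₂ ω) (fun y => covD1 Γ σ y u) x v w := by
  unfold secondOp1
  rw [fderiv_clm_apply_const (hd v), fderiv_clm_apply_const (hd u)]
  conv_rhs => unfold covD1
  simp only [covD1, add_apply]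
  ring

/-- Derivative of a component of the covariant derivative of a 1-form. -/
theorem fderiv_component {a p q : E3 → ℝ} {F : E3 → Cov3} {x : E3} (v u : E3)
    {s t : E3 → Cov3}
    (ha : a =ᶠ[nhds x] fun y => F y v + p y * s y v + q y * t y v)
    (hF : DifferentiableAt ℝ F x) (hp : DifferentiableAt ℝ p x) (hq : DifferentiableAt ℝ q x)
    (hs : DifferentiableAt ℝ s x) (ht : DifferentiableAt ℝ t x) :
    fderiv ℝ a x u = fderiv ℝ F x u v + fderiv ℝ p x u * s x v + p x * fderiv ℝ s x u v
      + fderiv ℝ q x u * t x v + q x * fderiv ℝ t x u v := by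
  rw [ha.fderiv_eq, fderiv_fun_add (by fun_prop) (by fun_prop),
    fderiv_fun_add (by fun_prop) (by fun_prop), fderiv_fun_mul hp (by fun_prop),
    fderiv_fun_mul hq (by fun_prop)]
  simp [fderiv_clm_apply_const, hF, hs, ht]
  ring

/-- If `dψ` restricted to the contact plane and the structure equations agree suitably, the
curvature of the connection with `∇e₁ = ψ ⊗ e₂`, `∇e₂ = -ψ ⊗ e₁` vanishes on the contact plane. -/
theorem secondOp1_christPC_eq_zero {U : Set E3} (hU : IsOpen U)
    {θ e₁ e₂ ω ψ σ : E3 → Cov3} {T X₁ X₂ : E3 → E3}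
    (h : IsDualFrame U θ e₁ e₂ T X₁ X₂)
    (hθ : SmoothOnD θ U) (he₁ : SmoothOnD e₁ U) (he₂ : SmoothOnD e₂ U)
    (hT : SmoothOnD T U) (hX₁ : SmoothOnD X₁ U) (hX₂ : SmoothOnD X₂ U)
    (hψ : SmoothOnD ψ U) (hσ : SmoothOnD σ U) {x : E3} (hx : x ∈ U) (u v w : E3)
    (hu : ψ x u = ω x u) (hv : ψ x v = ω x v)
    (h1 : extDer e₁ x u v = w2 ω e₂ x u v) (h2 : extDer e₂ x u v = - w2 ω e₁ x u v)
    (h3 : extDer ψ x u v = 0) :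
    secondOp1 θ e₁ e₂ T X₁ X₂ ω (christPC θ e₁ e₂ T X₁ X₂ ψ) σ x u v w = 0 := by
  have hd := differentiableAt_covD1_christPC hU hθ he₁ he₂ hT hX₁ hX₂ hψ hσ hx
  have dT := hT.differentiableAt' hU hx
  have dX₁ := hX₁.differentiableAt' hU hx
  have dX₂ := hX₂.differentiableAt' hU hx
  have hf : SmoothOnD (fun y => σ y (T y)) U := hσ.clm_apply hT
  have hg : SmoothOnD (fun y => σ y (X₁ y)) U := hσ.clm_apply hX₁
  have hk : SmoothOnD (fun y => σ y (X₂ y)) U := hσ.clm_apply hX₂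
  have key : ∀ y ∈ U, ∀ z w, covD1 (christPC θ e₁ e₂ T X₁ X₂ ψ) σ y z w = _ := fun y hy z w =>
    covD1_christPC_apply h ψ hy (hσ.differentiableAt' hU hy) (hT.differentiableAt' hU hy)
      (hX₁.differentiableAt' hU hy) (hX₂.differentiableAt' hU hy) z w
  rw [secondOp1_eq hd, covD1_christPC_apply h ω hx (hd v) dT dX₁ dX₂,
    covD1_christPC_apply h ω hx (hd u) dT dX₁ dX₂]
  have c0 : ∀ z, ∀ y ∈ U, covD1 (christPC θ e₁ e₂ T X₁ X₂ ψ) σ y z (T y)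
      = fderiv ℝ (fun y => σ y (T y)) y z := by
    intro z y hy
    obtain ⟨a1, a2, a3, -⟩ := h y hy
    rw [key y hy, a1, a2, a3]; ring
  have c1 : ∀ z, ∀ y ∈ U, covD1 (christPC θ e₁ e₂ T X₁ X₂ ψ) σ y z (X₁ y)
      = fderiv ℝ (fun y => σ y (X₁ y)) y z + -σ y (T y) * e₂ y z + -σ y (X₂ y) * ψ y z := by
    intro z y hy
    obtain ⟨-, -, -, a1, a2, a3, -⟩ := h y hy
    rw [key y hy, a1, a2, a3]; ring
  have c2 : ∀ z, ∀ y ∈ U, covD1 (christPC θ e₁ e₂ T X₁ X₂ ψ) σ y z (X₂ y)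
      = fderiv ℝ (fun y => σ y (X₂ y)) y z + σ y (T y) * e₁ y z + σ y (X₁ y) * ψ y z := by
    intro z y hy
    obtain ⟨-, -, -, -, -, -, a1, a2, a3⟩ := h y hy
    rw [key y hy, a1, a2, a3]; ring
  have hev : ∀ᶠ y in nhds x, y ∈ U := hU.mem_nhds hx
  have df := hf.differentiableAt' hU hx
  have dg := hg.differentiableAt' hU hx
  have dk := hk.differentiableAt' hU hx
  have d0 : ∀ z z', fderiv ℝ (fun y => covD1 (christPC θ e₁ e₂ T X₁ X₂ ψ) σ y z (T y)) x z'
      = fderiv ℝ (fderiv ℝ (fun y => σ y (T y))) x z' z := by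
    intro z z'
    rw [Filter.EventuallyEq.fderiv_eq (hev.mono (c0 z)),
      fderiv_clm_apply_const ((hf.fderiv' hU).differentiableAt' hU hx)]
  have d1 := fun z z' => fderiv_component z z' (hev.mono (c1 z))
    ((hg.fderiv' hU).differentiableAt' hU hx) df.fun_neg dk.fun_neg
    (he₂.differentiableAt' hU hx) (hψ.differentiableAt' hU hx)
  have d2 := fun z z' => fderiv_component z z' (hev.mono (c2 z))
    ((hk.fderiv' hU).differentiableAt' hU hx) df dg
    (he₁.differentiableAt' hU hx) (hψ.differentiableAt' hU hx)
  simp only [fderiv_fun_neg, neg_apply] at d1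
  rw [d0, d0, d1, d1, d2, d2, c0 _ x hx, c0 _ x hx, c1 _ x hx, c1 _ x hx, c2 _ x hx, c2 _ x hx,
    hf.fderiv_symm hU hx v u, hg.fderiv_symm hU hx v u, hk.fderiv_symm hU hx v u, hu, hv]
  simp only [extDer, w2] at h1 h2 h3
  linear_combination (-σ x (T x) * e₁ x w) * h2 + (-σ x (X₂ x) * e₁ x w) * h3
    + (σ x (T x) * e₂ x w) * h1 + (σ x (X₁ x) * e₂ x w) * h3

/-- Two connections with the same restriction to the contact plane, on which the second operator
vanishes, also agree on the Reeb field. -/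
theorem eq_of_secondOp1_eq_zero {U : Set E3} (hU : IsOpen U)
    {θ e₁ e₂ ω : E3 → Cov3} {T X₁ X₂ : E3 → E3} {Γ Γ' : E3 → E3 → Cov3 → Cov3} {x : E3}
    (hx : x ∈ U) {α : Cov3}
    (h : IsDualFrame U θ e₁ e₂ T X₁ X₂) (hθ : DifferentiableAt ℝ θ x)
    (hdθ : extDer θ x (X₁ x) (X₂ x) = 1)
    (hΓ : ∀ (u v : E3) (c : ℝ) (y : E3), Γ y (u + c • v) α = Γ y u α + c • Γ y v α)
    (hΓ' : ∀ (u v : E3) (c : ℝ) (y : E3), Γ' y (u + c • v) α = Γ' y u α + c • Γ' y v α)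
    (hdiff : DifferentiableAt ℝ (fun y => Γ' y (T y) α - Γ y (T y) α) x)
    (hd : ∀ v, DifferentiableAt ℝ (fun y => covD1 Γ (fun _ => α) y v) x)
    (hH : ∀ y ∈ U, ∀ u, θ y u = 0 → Γ' y u α = Γ y u α)
    (h0 : ∀ u v w, θ x u = 0 → θ x v = 0 →
      secondOp1 θ e₁ e₂ T X₁ X₂ ω Γ (fun _ => α) x u v w = 0)
    (h0' : ∀ u v w, θ x u = 0 → θ x v = 0 →
      secondOp1 θ e₁ e₂ T X₁ X₂ ω Γ' (fun _ => α) x u v w = 0) (u : E3) :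
    Γ' x u α = Γ x u α := by
  set C : E3 → Cov3 := fun y => Γ' y (T y) α - Γ y (T y) α with hC
  have key : ∀ y ∈ U, ∀ v, Γ' y v α = Γ y v α + θ y v • C y := by
    intro y hy v
    have hz : θ y (v - θ y v • T y) = 0 := by simp [(h y hy).1]
    have e1 := hΓ (v - θ y v • T y) (T y) (θ y v) y
    have e2 := hΓ' (v - θ y v • T y) (T y) (θ y v) y
    rw [sub_add_cancel] at e1 e2
    rw [e1, e2, hH y hy _ hz, hC]
    module
  have hcov : ∀ y ∈ U, ∀ v, covD1 Γ' (fun _ => α) y v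
      = covD1 Γ (fun _ => α) y v + θ y v • C y := by
    intro y hy v
    simp only [covD1, key y hy v, add_assoc]
  have hder : ∀ v w z, θ x v = 0 →
      fderiv ℝ (fun y => covD1 Γ' (fun _ => α) y v w) x z
        = fderiv ℝ (fun y => covD1 Γ (fun _ => α) y v w) x z + fderiv ℝ θ x z v * C x w := by
    intro v w z hv
    have hev : (fun y => covD1 Γ' (fun _ => α) y v w) =ᶠ[nhds x]
        fun y => covD1 Γ (fun _ => α) y v w + θ y v * C y w := by
      filter_upwards [hU.mem_nhds hx] with y hy
      rw [hcov y hy v]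
      simp
    have hdv := hd v
    rw [hev.fderiv_eq, fderiv_fun_add (by fun_prop) (by fun_prop),
      fderiv_fun_mul (by fun_prop) (by fun_prop)]
    simp [hv, fderiv_clm_apply_const hθ, mul_comm]
  have hX₁ : θ x (X₁ x) = 0 := (h x hx).2.2.2.1
  have hX₂ : θ x (X₂ x) = 0 := (h x hx).2.2.2.2.2.2.1
  have hCx : C x = 0 := by
    ext w
    have a := h0 _ _ w hX₁ hX₂
    have b := h0' _ _ w hX₁ hX₂
    unfold secondOp1 at a b
    rw [hder _ _ _ hX₁, hder _ _ _ hX₂, hcov x hx, hcov x hx, hX₁, hX₂, zero_smul, add_zero,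
      add_zero] at b
    unfold extDer at hdθ
    simp only [zero_apply]
    linear_combination b - a - C x w * hdθ
  rw [key x hx, hCx, smul_zero, add_zero]

/-- On a 3-dimensional pseudo-Hermitian manifold with local coframe
`θ, e₁, e₂` (`dθ = e₁∧e₂`, `J e₂ = e₁`) and `ω` from the structure equations, the
canonical partial connection `∇_Hθ = e₁⊗e₂ - e₂⊗e₁`, `∇_He₁ = ω_H⊗e₂`,
`∇_He₂ = -ω_H⊗e₁` on `Λ¹` has a unique promotion to a full connection `∇` on `Λ¹`
satisfying the conditions of the promotion proposition (its `H`-part is `∇_H`, and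
`Λ¹ →(∇) Λ¹⊗Λ¹ →(∇_H) Λ²_H⊗Λ¹ →(𝓛⁻¹⊗Id) L⊗Λ¹` vanishes; in dimension 3 the latter
says that the `Λ²_H⊗Λ¹`-valued composition vanishes on `H × H`), and the promotion is
given by `∇θ = e₁⊗e₂ - e₂⊗e₁`, `∇e₁ = (ω - Rθ)⊗e₂`, `∇e₂ = (Rθ - ω)⊗e₁`, where `R`
is the Tanaka–Webster curvature function, `dω∧θ = R θ∧e₁∧e₂`. -/
theorem statement12 (U : Set E3) (hU : IsOpen U)
    (θ e₁ e₂ : E3 → Cov3) (J : E3 → (E3 →L[ℝ] E3))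
    (T X₁ X₂ : E3 → E3) (ω : E3 → Cov3) (A B R : E3 → ℝ)
    (hθ : IsContactForm U θ)
    (hco : IsAdaptedCoframe U θ e₁ e₂)
    (hJ : JCompat U θ e₁ e₂ J)
    (hdual : IsDualFrame U θ e₁ e₂ T X₁ X₂)
    (hTsm : SmoothOnD T U) (hX₁sm : SmoothOnD X₁ U) (hX₂sm : SmoothOnD X₂ U)
    (hω : SmoothOnD ω U) (hRsm : SmoothOnD R U)
    (hstr : StructureEquations U θ e₁ e₂ ω A B)
    -- R is the Tanaka-Webster curvature: dω∧θ = R θ∧e₁∧e₂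
    (hR : ∀ x ∈ U, ∀ u v w : E3, dωθ ω θ x u v w = R x * w111 θ e₁ e₂ x u v w) :
    -- the claimed connection is a promotion of the canonical partial connection:
    -- (i) its H-part is the canonical partial connection
    (∀ x ∈ U, ∀ u : E3, θ x u = 0 → ∀ α : Cov3,
      christProm θ e₁ e₂ T X₁ X₂ ω R x u α = christPC θ e₁ e₂ T X₁ X₂ ω x u α) ∧
    -- (ii) the composition `(𝓛⁻¹⊗Id) ∘ ∇_H ∘ ∇` vanishes
    (∀ σ : E3 → Cov3, SmoothOnD σ U → ∀ x ∈ U, ∀ u v : E3, θ x u = 0 → θ x v = 0 →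
      ∀ w : E3,
        secondOp1 θ e₁ e₂ T X₁ X₂ ω (christProm θ e₁ e₂ T X₁ X₂ ω R) σ x u v w = 0) ∧
    -- uniqueness of the promotion
    (∀ Γ' : E3 → E3 →L[ℝ] Cov3 →L[ℝ] Cov3, SmoothOnD Γ' U →
      (∀ x ∈ U, ∀ u : E3, θ x u = 0 → ∀ α : Cov3,
        Γ' x u α = christPC θ e₁ e₂ T X₁ X₂ ω x u α) →
      (∀ σ : E3 → Cov3, SmoothOnD σ U → ∀ x ∈ U, ∀ u v : E3, θ x u = 0 → θ x v = 0 →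
        ∀ w : E3, secondOp1 θ e₁ e₂ T X₁ X₂ ω (fun x u α => Γ' x u α) σ x u v w = 0) →
      ∀ x ∈ U, ∀ u : E3, ∀ α : Cov3,
        Γ' x u α = christProm θ e₁ e₂ T X₁ X₂ ω R x u α) := by
  obtain ⟨hθs, he₁, he₂, -, hdθ⟩ := hco
  have hψ : SmoothOnD (fun y => ω y - R y • θ y) U := hω.sub (hRsm.smul hθs)
  have hi : ∀ x ∈ U, ∀ u : E3, θ x u = 0 → ∀ α : Cov3,
      christProm θ e₁ e₂ T X₁ X₂ ω R x u α = christPC θ e₁ e₂ T X₁ X₂ ω x u α := by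
    intro x _ u hu α
    simp [christProm, christPC, hu]
  have hii : ∀ σ : E3 → Cov3, SmoothOnD σ U → ∀ x ∈ U, ∀ u v : E3, θ x u = 0 → θ x v = 0 →
      ∀ w : E3,
        secondOp1 θ e₁ e₂ T X₁ X₂ ω (christProm θ e₁ e₂ T X₁ X₂ ω R) σ x u v w = 0 := by
    intro σ hσ x hx u v hu hv w
    rw [christProm_eq_christPC]
    obtain ⟨s1, s2⟩ := hstr x hx u v
    refine secondOp1_christPC_eq_zero hU hdual hθs he₁ he₂ hTsm hX₁sm hX₂sm hψ hσ hx u v w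
      (by simp [hu]) (by simp [hv]) ?_ ?_ ?_
    · rw [s1]; simp [w2, hu, hv]
    · rw [s2]; simp [w2, hu, hv]
    · have r := hR x hx u v (T x)
      have t := hdθ x hx u v
      have dR := hRsm.differentiableAt' hU hx
      have dθ := hθs.differentiableAt' hU hx
      obtain ⟨a1, a2, a3, -⟩ := hdual x hx
      simp only [dωθ, w111, hu, hv, a1, mul_zero, zero_mul, mul_one, one_mul, add_zero, sub_zero,
        zero_add] at r
      unfold extDer
      rw [fderiv_fun_sub (hω.differentiableAt' hU hx) (dR.fun_smul dθ), fderiv_fun_smul dR dθ]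
      simp only [extDer] at r t
      simp [hu, hv]
      linear_combination r - R x * t
  refine ⟨hi, hii, ?_⟩
  intro Γ' hΓ' hH h0 x hx u α
  have dΓ := hΓ'.differentiableAt' hU hx
  have dT := hTsm.differentiableAt' hU hx
  have hconst : SmoothOnD (fun _ : E3 => α) U := contDiffOn_const
  have hd := differentiableAt_covD1_christPC hU hθs he₁ he₂ hTsm hX₁sm hX₂sm hψ hconst hx
  have hdT : DifferentiableAt ℝ
      (fun y => christPC θ e₁ e₂ T X₁ X₂ (fun y => ω y - R y • θ y) y (T y) α) x := by
    have d1 := hθs.differentiableAt' hU hx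
    have d2 := he₁.differentiableAt' hU hx
    have d3 := he₂.differentiableAt' hU hx
    have d5 := hX₁sm.differentiableAt' hU hx
    have d6 := hX₂sm.differentiableAt' hU hx
    have d7 := hω.differentiableAt' hU hx
    have d8 := hRsm.differentiableAt' hU hx
    have d10 := (hTsm.fderiv' hU).differentiableAt' hU hx
    have d11 := (hX₁sm.fderiv' hU).differentiableAt' hU hx
    have d12 := (hX₂sm.fderiv' hU).differentiableAt' hU hx
    unfold christPC
    fun_prop
  have hone : extDer θ x (X₁ x) (X₂ x) = 1 := by
    obtain ⟨-, -, -, -, b1, b2, -, b4, b5⟩ := hdual x hx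
    rw [hdθ x hx]
    simp [w2, b1, b2, b4, b5]
  rw [← christProm_eq_christPC] at hd hdT
  refine eq_of_secondOp1_eq_zero (Γ' := fun x u α => Γ' x u α) hU hx hdual
    (hθs.differentiableAt' hU hx) hone ?_ ?_ (DifferentiableAt.fun_sub (by fun_prop) hdT) hd
    (fun y hy u hu => (hH y hy u hu α).trans (hi y hy u hu α).symm)
    (fun u v w hu hv => hii _ hconst x hx u v hu hv w)
    (fun u v w hu hv => h0 _ hconst x hx u v hu hv w) u
  · intro u v c y
    simp only [christProm_eq_christPC, christPC_add_smul]
  · intro u v c y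
    simp
end
end

section
/- Let M be a 3-dimensional pseudo-Hermitian manifold with local coframe θ, e₁, e₂ (dθ = e₁∧e₂, Je₂ = e₁) and ω, R as in the structure equations and dω∧θ = Rθ∧e₁∧e₂. Then the difference tensor between the promoted canonical connection (∇θ = e₁⊗e₂ − e₂⊗e₁, ∇e₁ = (ω−Rθ)⊗e₂, ∇e₂ = (Rθ−ω)⊗e₁) and the Tanaka–Webster connection (∇θ = 0, ∇e₁ = ω⊗e₂, ∇e₂ = −ω⊗e₁), as a bundle homomorphism Λ¹ → Λ¹⊗Λ¹ written in the splitting Λ¹ = Λ¹_H ⊕ Λ⁰ determined by the Reeb field of θ, is (σ, ρ) ↦ (Rθ⊗Jσ + Ωρ, 0), where Ω = dθ and J acts on Λ¹_H by duality. -/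
set_option maxSynthPendingDepth 5

noncomputable section

/-- Christoffel term of the Tanaka–Webster connection `∇θ = 0`, `∇e₁ = ω ⊗ e₂`,
`∇e₂ = -ω ⊗ e₁` on `Λ¹`. -/
def christTW (θ e₁ e₂ : E3 → Cov3) (T X₁ X₂ : E3 → E3) (ω : E3 → Cov3)
    (x u : E3) (α : Cov3) : Cov3 :=
  α (fderiv ℝ T x u) • θ x + α (fderiv ℝ X₁ x u) • e₁ x + α (fderiv ℝ X₂ x u) • e₂ x
    + (α (X₁ x) * ω x u) • e₂ x - (α (X₂ x) * ω x u) • e₁ x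

/-- A vector of `E3` is the combination of a frame with coefficients given by the dual coframe. -/
theorem eq_sum_dual_frame {a b c : Cov3} {T X Y : E3}
    (haT : a T = 1) (hbT : b T = 0) (hcT : c T = 0)
    (haX : a X = 0) (hbX : b X = 1) (hcX : c X = 0)
    (haY : a Y = 0) (hbY : b Y = 0) (hcY : c Y = 1) (v : E3) :
    v = a v • T + b v • X + c v • Y := by
  let L : E3 →ₗ[ℝ] (Fin 3 → ℝ) :=
    LinearMap.pi ![(a : E3 →ₗ[ℝ] ℝ), (b : E3 →ₗ[ℝ] ℝ), (c : E3 →ₗ[ℝ] ℝ)]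
  have hsurj : Function.Surjective L := by
    intro y
    refine ⟨y 0 • T + y 1 • X + y 2 • Y, ?_⟩
    ext i
    fin_cases i <;> simp [L, haT, hbT, hcT, haX, hbX, hcX, haY, hbY, hcY]
  have hinj : Function.Injective L :=
    (LinearMap.injective_iff_surjective_of_finrank_eq_finrank (by simp)).2 hsurj
  apply hinj
  ext i
  fin_cases i <;> simp [L, haT, hbT, hcT, haX, hbX, hcX, haY, hbY, hcY]

/-- In an adapted frame, `J w = e₁(w) X₂ - e₂(w) X₁`. -/
theorem JCompat.apply_eq {U : Set E3} {θ e₁ e₂ : E3 → Cov3} {J : E3 → (E3 →L[ℝ] E3)}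
    {T X₁ X₂ : E3 → E3} (hJ : JCompat U θ e₁ e₂ J) (hJT : ∀ x ∈ U, J x (T x) = 0)
    (hdual : IsDualFrame U θ e₁ e₂ T X₁ X₂) {x : E3} (hx : x ∈ U) (w : E3) :
    J x w = e₁ x w • X₂ x - e₂ x w • X₁ x := by
  obtain ⟨hH, hsq, hdualJ⟩ := hJ
  obtain ⟨h1, h2, h3, h4, h5, h6, h7, h8, h9⟩ := hdual x hx
  have hsum := eq_sum_dual_frame h1 h2 h3 h4 h5 h6 h7 h8 h9
  have hJH : ∀ v, θ x v = 0 → J x v = e₁ x v • X₂ x - e₂ x v • X₁ x := by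
    intro v hv
    have he₁ : e₁ x (J x v) = -e₂ x v := by
      rw [hdualJ x hx _ (hH x hx v hv), hsq x hx v hv, map_neg]
    rw [hsum (J x v), hH x hx v hv, he₁, ← hdualJ x hx v hv]
    module
  conv_lhs => rw [hsum w]
  simp only [map_add, map_smul, hJT x hx, hJH _ h4, hJH _ h7, h5, h6, h8, h9]
  module

/-- On a 3-dimensional pseudo-Hermitian manifold with local coframe
`θ, e₁, e₂` (`dθ = e₁∧e₂`, `J e₂ = e₁`), with `ω` from the structure equations and `R`
the Tanaka–Webster curvature (`dω∧θ = Rθ∧e₁∧e₂`), the difference tensor between the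
promoted canonical connection (`∇θ = e₁⊗e₂ - e₂⊗e₁`, `∇e₁ = (ω-Rθ)⊗e₂`,
`∇e₂ = (Rθ-ω)⊗e₁`) and the Tanaka–Webster connection (`∇θ = 0`, `∇e₁ = ω⊗e₂`,
`∇e₂ = -ω⊗e₁`), as a bundle homomorphism `Λ¹ → Λ¹⊗Λ¹` written in the splitting
`Λ¹ = Λ¹_H ⊕ Λ⁰` determined by the Reeb field of `θ`, is
`(σ, ρ) ↦ (Rθ⊗Jσ + Ωρ, 0)`, where `Ω = dθ` and `J` acts on `Λ¹_H` by duality.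

In the splitting, a 1-form `α` corresponds to the pair `(α_H, ρ) = (α - α(T)θ, α(T))`,
and the value of the difference tensor on `α`, evaluated at `(u, w)`, is
`R θ(u) · α_H(J w) + α(T) · dθ(u, w)`. -/
theorem statement13 (U : Set E3) (hU : IsOpen U)
    (θ e₁ e₂ : E3 → Cov3) (J : E3 → (E3 →L[ℝ] E3))
    (T X₁ X₂ : E3 → E3) (ω : E3 → Cov3) (A B R : E3 → ℝ)
    (hθ : IsContactForm U θ)
    (hco : IsAdaptedCoframe U θ e₁ e₂)
    (hJ : JCompat U θ e₁ e₂ J)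
    -- J kills the Reeb field (so that J is an endomorphism of H ⊆ TM)
    (hJT : ∀ x ∈ U, J x (T x) = 0)
    (hdual : IsDualFrame U θ e₁ e₂ T X₁ X₂)
    (hTsm : SmoothOnD T U) (hX₁sm : SmoothOnD X₁ U) (hX₂sm : SmoothOnD X₂ U)
    (hω : SmoothOnD ω U)
    (hstr : StructureEquations U θ e₁ e₂ ω A B)
    (hR : ∀ x ∈ U, ∀ u v w : E3, dωθ ω θ x u v w = R x * w111 θ e₁ e₂ x u v w) :
    ∀ x ∈ U, ∀ (α : Cov3) (u w : E3),
      christProm θ e₁ e₂ T X₁ X₂ ω R x u α w - christTW θ e₁ e₂ T X₁ X₂ ω x u α w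
        = R x * θ x u * ((α - α (T x) • θ x) (J x w)) + α (T x) * extDer θ x u w := by
  intro x hx α u w
  obtain ⟨-, -, -, h4, -, -, h7, -, -⟩ := hdual x hx
  rw [hco.2.2.2.2 x hx u w, hJ.apply_eq hJT hdual hx w]
  simp only [christProm, christTW, w2, add_apply,
    sub_apply, smul_apply, smul_eq_mul,
    map_sub, map_smul, h4, h7]
  ring
end
end
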